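/- arXiv:1304.7651 — 5 statements merged into one kernel-verified Lean document; each statement's English description precedes it below -/
import Mathlib

section
/- Let (X,d) be a metric space, x₀ ∈ X, and let Λ be a set of geodesic rays in X based at x₀ such that for any two distinct r,r' ∈ Λ the function t ↦ d(r(t),r'(t)) is convex on [0,∞). Fix A > 0. For distinct r,r' ∈ Λ let t_A(r,r') denote the unique t > 0 with d(r(t),r'(t)) = A, and set d_A(r,r') := 1/t_A(r,r') and d_A(r,r) := 0. Then d_A is a metric on Λ (in particular d_A satisfies the triangle inequality). -/
open scoped Classical

theorem ConvexOn.mul_le_mul_of_map_zero {f : ℝ → ℝ} (hf : ConvexOn ℝ (Set.Ici 0) f)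
    (h0 : f 0 = 0) {s t : ℝ} (hs : 0 ≤ s) (hst : s ≤ t) (ht : 0 < t) :
    f s ≤ s * t⁻¹ * f t := by
  have hle : s * t⁻¹ ≤ 1 := by
    rw [← div_eq_mul_inv]
    exact (div_le_one ht).2 hst
  have h := hf.2 (Set.mem_Ici.2 le_rfl) (Set.mem_Ici.2 ht.le) (sub_nonneg.2 hle)
    (by positivity : 0 ≤ s * t⁻¹) (by ring)
  simpa [h0, mul_assoc, ht.ne'] using h

theorem ConvexOn.eq_of_map_eq_of_map_zero {f : ℝ → ℝ} (hf : ConvexOn ℝ (Set.Ici 0) f)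
    (h0 : f 0 = 0) {A s t : ℝ} (hA : 0 < A) (hs : 0 < s) (ht : 0 < t)
    (hfs : f s = A) (hft : f t = A) : s = t := by
  wlog hst : s ≤ t generalizing s t
  · exact (this ht hs hft hfs (le_of_not_ge hst)).symm
  have h := hf.mul_le_mul_of_map_zero h0 hs.le hst ht
  rw [hfs, hft, le_mul_iff_one_le_left hA, ← div_eq_mul_inv, one_le_div ht] at h
  exact le_antisymm hst h

/-- Let `Λ` (here the set `S`) be a set of geodesic rays in a metric space `X`, based at
`x₀`, whose pairwise distance functions are convex on `[0,∞)`. Fix `A > 0` and for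
distinct rays let `tA r r'` be the unique `t > 0` with `dist (r t) (r' t) = A`. Then
`d_A(r,r') := 1 / tA r r'` (and `d_A(r,r) := 0`) is a metric on `Λ`: it is nonnegative,
vanishes exactly on the diagonal, is symmetric, and satisfies the triangle inequality. -/
theorem dA_is_metric {X : Type*} [MetricSpace X] (x₀ : X) (S : Set (ℝ → X))
    (hray : ∀ r ∈ S, r 0 = x₀ ∧ ∀ s t : ℝ, 0 ≤ s → 0 ≤ t → dist (r s) (r t) = |s - t|)
    (hconv : ∀ r ∈ S, ∀ r' ∈ S, r ≠ r' →
      ConvexOn ℝ (Set.Ici 0) (fun t => dist (r t) (r' t)))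
    (A : ℝ) (hA : 0 < A)
    (tA : (ℝ → X) → (ℝ → X) → ℝ)
    (htA : ∀ r ∈ S, ∀ r' ∈ S, r ≠ r' →
      0 < tA r r' ∧ dist (r (tA r r')) (r' (tA r r')) = A) :
    let dA : (ℝ → X) → (ℝ → X) → ℝ := fun r r' => if r = r' then 0 else (tA r r')⁻¹
    (∀ r ∈ S, ∀ r' ∈ S, 0 ≤ dA r r') ∧
    (∀ r ∈ S, ∀ r' ∈ S, (dA r r' = 0 ↔ r = r')) ∧
    (∀ r ∈ S, ∀ r' ∈ S, dA r r' = dA r' r) ∧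
    (∀ r ∈ S, ∀ r' ∈ S, ∀ r'' ∈ S, dA r r'' ≤ dA r r' + dA r' r'') := by
  intro dA
  have hself : ∀ r, dA r r = 0 := fun r => if_pos rfl
  have hne : ∀ {r r'}, r ≠ r' → dA r r' = (tA r r')⁻¹ := fun h => if_neg h
  have hzero : ∀ r ∈ S, ∀ r' ∈ S, dist (r 0) (r' 0) = 0 := fun r hr r' hr' => by
    rw [(hray r hr).1, (hray r' hr').1, dist_self]
  have hnonneg : ∀ r ∈ S, ∀ r' ∈ S, 0 ≤ dA r r' := by
    intro r hr r' hr'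
    by_cases h : r = r'
    · rw [h, hself]
    · rw [hne h]
      exact (inv_pos.2 (htA r hr r' hr' h).1).le
  refine ⟨hnonneg, ?_, ?_, ?_⟩
  · intro r hr r' hr'
    refine ⟨fun h0 => ?_, fun h => h ▸ hself r⟩
    by_contra h
    rw [hne h] at h0
    exact (inv_pos.2 (htA r hr r' hr' h).1).ne' h0
  · intro r hr r' hr'
    by_cases h : r = r'
    · rw [h]
    obtain ⟨hs, hds⟩ := htA r hr r' hr' h
    obtain ⟨ht, hdt⟩ := htA r' hr' r hr (Ne.symm h)
    rw [dist_comm] at hdt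
    rw [hne h, hne (Ne.symm h), (hconv r hr r' hr' h).eq_of_map_eq_of_map_zero
      (hzero r hr r' hr') hA hs ht hds hdt]
  · intro r hr r' hr' r'' hr''
    by_cases h : r = r''
    · subst h
      rw [hself]
      exact add_nonneg (hnonneg r hr r' hr') (hnonneg r' hr' r hr)
    by_cases h₁ : r = r'
    · rw [h₁, hself, zero_add]
    by_cases h₂ : r' = r''
    · rw [h₂, hself, add_zero]
    obtain ⟨hc, hdc⟩ := htA r hr r'' hr'' h
    obtain ⟨ha, hda⟩ := htA r hr r' hr' h₁
    obtain ⟨hb, hdb⟩ := htA r' hr' r'' hr'' h₂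
    rw [hne h, hne h₁, hne h₂]
    set a := tA r r'
    set b := tA r' r''
    set c := tA r r''
    rcases le_total a c with hac | hca
    · exact (inv_anti₀ ha hac).trans (le_add_of_nonneg_right (inv_pos.2 hb).le)
    rcases le_total b c with hbc | hcb
    · exact (inv_anti₀ hb hbc).trans (le_add_of_nonneg_left (inv_pos.2 ha).le)
    have h1 := (hconv r hr r' hr' h₁).mul_le_mul_of_map_zero (hzero r hr r' hr') hc.le hca ha
    have h2 := (hconv r' hr' r'' hr'' h₂).mul_le_mul_of_map_zero
      (hzero r' hr' r'' hr'') hc.le hcb hb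
    have htri := dist_triangle (r c) (r' c) (r'' c)
    simp only [hda, hdb] at h1 h2
    have hle : 1 * A ≤ (a⁻¹ + b⁻¹) * c * A := by linarith
    rw [inv_le_iff_one_le_mul₀ hc]
    exact le_of_mul_le_mul_right hle hA
end

section
/- Let (X,d) be a compact metric space and let g be a gap function on X. Then g is compatible with d — meaning: for every ε>0 there exists δ>0 such that for all x,y ∈ X, g(x,y)<δ implies d(x,y)<ε, and d(x,y)<δ implies g(x,y)<ε — if and only if the following two conditions hold: (1) for every finite open cover 𝒰 of X there exists ε>0 such that whenever g(x,y)<ε there is some U ∈ 𝒰 with x ∈ U and y ∈ U; (2) for every ε>0 there exists a finite open cover 𝒰 of X such that g(x,y)<ε whenever x,y ∈ U for some U ∈ 𝒰. -/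
/-- Points at small distance lie in a common member of a given finite open cover. -/
theorem exists_pos_dist_lt_imp_mem_cover {X : Type*} [PseudoMetricSpace X] [CompactSpace X]
    (𝒰 : Finset (Set X)) (ho : ∀ U ∈ 𝒰, IsOpen U) (hc : ∀ x : X, ∃ U ∈ 𝒰, x ∈ U) :
    ∃ δ > (0 : ℝ), ∀ x y : X, dist x y < δ → ∃ U ∈ 𝒰, x ∈ U ∧ y ∈ U := by
  obtain ⟨δ, hδ, h⟩ := lebesgue_number_lemma_of_metric_sUnion (c := (𝒰 : Set (Set X)))
    isCompact_univ ho (fun x _ => hc x)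
  refine ⟨δ, hδ, fun x y hxy => ?_⟩
  obtain ⟨U, hU, hb⟩ := h x (Set.mem_univ x)
  exact ⟨U, hU, hb (Metric.mem_ball_self hδ), hb (Metric.mem_ball'.2 hxy)⟩

/-- A compact space has finite open covers whose members are arbitrarily small. -/
theorem exists_finset_open_cover_dist_lt (X : Type*) [PseudoMetricSpace X] [CompactSpace X]
    {ε : ℝ} (hε : 0 < ε) :
    ∃ 𝒰 : Finset (Set X), (∀ U ∈ 𝒰, IsOpen U) ∧ (∀ x : X, ∃ U ∈ 𝒰, x ∈ U) ∧
      ∀ (x y : X) (U : Set X), U ∈ 𝒰 → x ∈ U → y ∈ U → dist x y < ε := by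
  classical
  obtain ⟨t, -, ht, hcov⟩ :=
    (isCompact_univ : IsCompact (Set.univ : Set X)).finite_cover_balls (half_pos hε)
  refine ⟨ht.toFinset.image fun c => Metric.ball c (ε / 2), ?_, fun x => ?_, ?_⟩
  · simp only [Finset.forall_mem_image]
    exact fun _ _ => Metric.isOpen_ball
  · obtain ⟨c, hc, hx⟩ := Set.mem_iUnion₂.1 (hcov (Set.mem_univ x))
    exact ⟨_, Finset.mem_image_of_mem _ (ht.mem_toFinset.2 hc), hx⟩
  · intro x y U hU hx hy
    obtain ⟨c, -, rfl⟩ := Finset.mem_image.1 hU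
    have hx' := Metric.mem_ball.1 hx
    have hy' := Metric.mem_ball.1 hy
    linarith [dist_triangle_right x y c]

/-- For a gap function `g` on a compact metric space `X`, compatibility of `g` with the
metric `d` (the pairwise `∀ε∃δ` condition) is equivalent to the two finite-open-cover
conditions: (1) for every finite open cover `𝒰` there is `ε > 0` such that points with
`g x y < ε` lie in a common member of `𝒰`; (2) for every `ε > 0` there is a finite open
cover `𝒰` such that points lying in a common member of `𝒰` satisfy `g x y < ε`. -/
theorem gapFunction_compatible_iff_covers {X : Type*} [MetricSpace X] [CompactSpace X]
    (g : X → X → ℝ)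
    (hsymm : ∀ x y, g x y = g y x)
    (hnonneg : ∀ x y, 0 ≤ g x y)
    (hzero : ∀ x y, g x y = 0 ↔ x = y) :
    (∀ ε > (0 : ℝ), ∃ δ > (0 : ℝ), ∀ x y : X,
        (g x y < δ → dist x y < ε) ∧ (dist x y < δ → g x y < ε))
      ↔
    ((∀ 𝒰 : Finset (Set X), (∀ U ∈ 𝒰, IsOpen U) → (∀ x : X, ∃ U ∈ 𝒰, x ∈ U) →
        ∃ ε > (0 : ℝ), ∀ x y : X, g x y < ε → ∃ U ∈ 𝒰, x ∈ U ∧ y ∈ U) ∧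
      (∀ ε > (0 : ℝ), ∃ 𝒰 : Finset (Set X), (∀ U ∈ 𝒰, IsOpen U) ∧
        (∀ x : X, ∃ U ∈ 𝒰, x ∈ U) ∧
        ∀ (x y : X) (U : Set X), U ∈ 𝒰 → x ∈ U → y ∈ U → g x y < ε)) := by
  constructor
  · refine fun h => ⟨fun 𝒰 ho hc => ?_, fun ε hε => ?_⟩
    · obtain ⟨η, hη, hcov⟩ := exists_pos_dist_lt_imp_mem_cover 𝒰 ho hc
      obtain ⟨δ, hδ, hg⟩ := h η hη
      exact ⟨δ, hδ, fun x y hxy => hcov x y ((hg x y).1 hxy)⟩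
    · obtain ⟨δ, hδ, hg⟩ := h ε hε
      obtain ⟨𝒰, ho, hc, hd⟩ := exists_finset_open_cover_dist_lt X hδ
      exact ⟨𝒰, ho, hc, fun x y U hU hx hy => (hg x y).2 (hd x y U hU hx hy)⟩
  · rintro ⟨h₁, h₂⟩ ε hε
    obtain ⟨𝒰, ho, hc, hd⟩ := exists_finset_open_cover_dist_lt X hε
    obtain ⟨δ₁, hδ₁, hg₁⟩ := h₁ 𝒰 ho hc
    obtain ⟨𝒱, ho', hc', hg₂⟩ := h₂ ε hε
    obtain ⟨δ₂, hδ₂, hcov⟩ := exists_pos_dist_lt_imp_mem_cover 𝒱 ho' hc'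
    refine ⟨min δ₁ δ₂, lt_min hδ₁ hδ₂, fun x y => ⟨fun hxy => ?_, fun hxy => ?_⟩⟩
    · obtain ⟨U, hU, hx, hy⟩ := hg₁ x y (hxy.trans_le (min_le_left _ _))
      exact hd x y U hU hx hy
    · obtain ⟨V, hV, hx, hy⟩ := hcov x y (hxy.trans_le (min_le_right _ _))
      exact hg₂ x y V hV hx hy
end

section
/- Let D ≥ 0 be a real number and let f : ℕ → [0,∞) satisfy f(s) ≤ (s/t)·f(t) + D for all integers 0 < s < t. Then either f(n) ≤ D for all n ≥ 1, or f(n) → ∞ as n → ∞. -/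
open Filter

/-- If `D ≥ 0` and `f : ℕ → [0,∞)` satisfies `f s ≤ (s/t) * f t + D` for all integers
`0 < s < t`, then either `f n ≤ D` for all `n ≥ 1`, or `f n → ∞` as `n → ∞`. -/
theorem almost_convex_dichotomy (D : ℝ) (hD : 0 ≤ D) (f : ℕ → ℝ)
    (hf : ∀ n, 0 ≤ f n)
    (hconv : ∀ s t : ℕ, 0 < s → s < t → f s ≤ ((s : ℝ) / (t : ℝ)) * f t + D) :
    (∀ n : ℕ, 1 ≤ n → f n ≤ D) ∨ Tendsto f atTop atTop := by
  by_cases h : ∀ n : ℕ, 1 ≤ n → f n ≤ D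
  · exact Or.inl h
  right
  push Not at h
  obtain ⟨s, hs, hD_lt⟩ := h
  have hs' : (0 : ℝ) < s := by exact_mod_cast hs
  have hlin : Tendsto (fun t : ℕ => (t : ℝ) * ((f s - D) / s)) atTop atTop :=
    tendsto_natCast_atTop_atTop.atTop_mul_const (div_pos (sub_pos.mpr hD_lt) hs')
  refine tendsto_atTop_mono' atTop ?_ hlin
  filter_upwards [eventually_gt_atTop s] with t hst
  have ht : (0 : ℝ) < t := by exact_mod_cast hs.trans hst.le
  have hle := hconv s t hs hst
  rw [div_mul_eq_mul_div, ← sub_le_iff_le_add, le_div_iff₀ ht] at hle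
  rw [← mul_div_assoc, div_le_iff₀ hs']
  linarith
end

section
/- Let (X,d) be a metric space, O ∈ X, and let D > 0 and A ≥ 2D+2 be real numbers. Let ℛ be a set of maps r : ℕ → X with r(0)=O and d(r(m),r(n)) = |m−n| for all m,n ∈ ℕ (discrete geodesic rays based at O), such that d(r(s),r'(s)) ≤ (s/t)·d(r(t),r'(t)) + D for all r,r' ∈ ℛ and all integers 0 < s < t. Define r ~ r' iff d(r(n),r'(n)) ≤ D for all n, and assume that ~ is transitive (hence an equivalence relation on ℛ). Then for any r,r' ∈ ℛ with r ≁ r', the set { n₀ ∈ ℕ : for all n ≥ n₀ and all ρ ∈ [r], ρ' ∈ [r'], d(ρ(n),ρ'(n)) ≥ A } is nonempty, so N([r],[r']) := its minimum is a well-defined positive integer; moreover, setting g(ξ,η) := 1/N(ξ,η) for distinct equivalence classes ξ ≠ η and g(ξ,ξ) := 0 defines a gap function on the quotient set ℛ/~. -/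
/-- If two sequences of points satisfy the almost-convexity inequality with constant `D` and are
further than `D` apart at some positive time, then their distance eventually exceeds any bound. -/
theorem exists_forall_ge_le_dist_of_almost_convex {X : Type*} [PseudoMetricSpace X] {r r' : ℕ → X}
    {D : ℝ} {s : ℕ} (hs : 0 < s) (hlt : D < dist (r s) (r' s))
    (hconv : ∀ t : ℕ, s < t →
      dist (r s) (r' s) ≤ ((s : ℝ) / (t : ℝ)) * dist (r t) (r' t) + D) (B : ℝ) :
    ∃ n₀ : ℕ, ∀ n ≥ n₀, B ≤ dist (r n) (r' n) := by
  have hs' : (0 : ℝ) < s := by exact_mod_cast hs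
  have hε : 0 < dist (r s) (r' s) - D := sub_pos.2 hlt
  obtain ⟨k, hk⟩ := exists_nat_ge (B * s / (dist (r s) (r' s) - D))
  refine ⟨max k (s + 1), fun n hn => ?_⟩
  have hkn : (k : ℝ) ≤ n := by exact_mod_cast (le_max_left _ _).trans hn
  have hsn : s < n := (le_max_right _ _).trans hn
  have hn' : (0 : ℝ) < n := by exact_mod_cast hs.trans hsn
  have hB : B * s ≤ n * (dist (r s) (r' s) - D) := (div_le_iff₀ hε).1 (hk.trans hkn)
  have hd : dist (r s) (r' s) - D ≤ s * dist (r n) (r' n) / n := by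
    linarith [hconv n hsn, div_mul_eq_mul_div (s : ℝ) n (dist (r n) (r' n))]
  rw [le_div_iff₀ hn'] at hd
  refine le_of_mul_le_mul_right ?_ hs'
  linarith

/-- Discrete geodesic rays in a metric space, based at `O`, satisfying the
almost-convexity inequality with constant `D`, with `r ~ r'` iff
`dist (r n) (r' n) ≤ D` for all `n` (assumed transitive). For inequivalent `r, r'`,
the set of thresholds `n₀` beyond which all representatives of the two classes stay
at distance `≥ A` is nonempty; its minimum `N([r],[r'])` is a positive integer
depending only on the classes and symmetric in them, so that
`g(ξ,η) = 1/N(ξ,η)` (for `ξ ≠ η`, and `g(ξ,ξ) = 0`) is a well-defined gap function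
on the quotient `ℛ/~`. -/
theorem gapFunction_on_ray_boundary {X : Type*} [MetricSpace X] (O : X)
    (D A : ℝ) (hD : 0 < D) (hA : 2 * D + 2 ≤ A)
    (R : Set (ℕ → X))
    (hray : ∀ r ∈ R, r 0 = O ∧ ∀ m n : ℕ, dist (r m) (r n) = |(m : ℝ) - (n : ℝ)|)
    (hconv : ∀ r ∈ R, ∀ r' ∈ R, ∀ s t : ℕ, 0 < s → s < t →
      dist (r s) (r' s) ≤ ((s : ℝ) / (t : ℝ)) * dist (r t) (r' t) + D)
    (sim : (ℕ → X) → (ℕ → X) → Prop)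
    (hsim : ∀ r r' : ℕ → X, (sim r r' ↔ ∀ n : ℕ, dist (r n) (r' n) ≤ D))
    (htrans : ∀ r ∈ R, ∀ r' ∈ R, ∀ r'' ∈ R, sim r r' → sim r' r'' → sim r r'') :
    ∀ r ∈ R, ∀ r' ∈ R, ¬ sim r r' →
      ({n₀ : ℕ | ∀ n ≥ n₀, ∀ ρ ∈ R, ∀ ρ' ∈ R, sim ρ r → sim ρ' r' →
          A ≤ dist (ρ n) (ρ' n)}.Nonempty) ∧
      (0 < sInf {n₀ : ℕ | ∀ n ≥ n₀, ∀ ρ ∈ R, ∀ ρ' ∈ R, sim ρ r → sim ρ' r' →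
          A ≤ dist (ρ n) (ρ' n)}) ∧
      -- `N` depends only on the equivalence classes, so `g` is well defined on `ℛ/~`:
      (∀ r₁ ∈ R, ∀ r₁' ∈ R, sim r₁ r → sim r₁' r' →
        sInf {n₀ : ℕ | ∀ n ≥ n₀, ∀ ρ ∈ R, ∀ ρ' ∈ R, sim ρ r₁ → sim ρ' r₁' →
            A ≤ dist (ρ n) (ρ' n)}
          = sInf {n₀ : ℕ | ∀ n ≥ n₀, ∀ ρ ∈ R, ∀ ρ' ∈ R, sim ρ r → sim ρ' r' →
            A ≤ dist (ρ n) (ρ' n)}) ∧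
      -- `N`, and hence `g`, is symmetric:
      (sInf {n₀ : ℕ | ∀ n ≥ n₀, ∀ ρ ∈ R, ∀ ρ' ∈ R, sim ρ r' → sim ρ' r →
          A ≤ dist (ρ n) (ρ' n)}
        = sInf {n₀ : ℕ | ∀ n ≥ n₀, ∀ ρ ∈ R, ∀ ρ' ∈ R, sim ρ r → sim ρ' r' →
          A ≤ dist (ρ n) (ρ' n)}) := by
  intro r hr r' hr' hne
  have hsymm : ∀ {a b : ℕ → X}, sim a b → sim b a := fun {a b} h =>
    (hsim b a).2 fun n => dist_comm (a n) (b n) ▸ (hsim a b).1 h n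
  have hzero : dist (r 0) (r' 0) = 0 := by rw [(hray r hr).1, (hray r' hr').1, dist_self]
  have hrefl : ∀ a : ℕ → X, sim a a := fun a => (hsim a a).2 fun n => by
    rw [dist_self]; exact hD.le
  have hnonempty : {n₀ : ℕ | ∀ n ≥ n₀, ∀ ρ ∈ R, ∀ ρ' ∈ R, sim ρ r → sim ρ' r' →
      A ≤ dist (ρ n) (ρ' n)}.Nonempty := by
    obtain ⟨s, hs⟩ : ∃ s, D < dist (r s) (r' s) := by
      by_contra! h
      exact hne ((hsim r r').2 h)
    have hspos : 0 < s := Nat.pos_of_ne_zero fun h => by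
      rw [h, hzero] at hs
      exact hs.not_gt hD
    obtain ⟨n₀, hn₀⟩ := exists_forall_ge_le_dist_of_almost_convex hspos hs
      (fun t ht => hconv r hr r' hr' s t hspos ht) (A + 2 * D)
    refine ⟨n₀, fun n hn ρ _ ρ' _ hρ hρ' => ?_⟩
    have h := dist_triangle4 (r n) (ρ n) (ρ' n) (r' n)
    linarith [hn₀ n hn, (hsim _ _).1 (hsymm hρ) n, (hsim _ _).1 hρ' n]
  refine ⟨hnonempty, Nat.pos_of_ne_zero fun h => ?_, fun r₁ hr₁ r₁' hr₁' h₁ h₁' => ?_, ?_⟩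
  · have hmem := Nat.sInf_mem hnonempty
    rw [h] at hmem
    linarith [hmem 0 le_rfl r hr r' hr' (hrefl r) (hrefl r')]
  · have hclass : ∀ {a b : ℕ → X}, a ∈ R → b ∈ R → sim a b →
        ∀ ρ ∈ R, (sim ρ a ↔ sim ρ b) := fun {a b} ha hb hab ρ hρ =>
      ⟨fun h => htrans ρ hρ a ha b hb h hab,
        fun h => htrans ρ hρ b hb a ha h (hsymm hab)⟩
    congr 1
    ext n₀
    refine forall₂_congr fun n _ => forall₂_congr fun ρ hρ => forall₂_congr fun ρ' hρ' => ?_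
    rw [hclass hr₁ hr h₁ ρ hρ, hclass hr₁' hr' h₁' ρ' hρ']
  · congr 1
    ext n₀
    exact forall₂_congr fun n _ =>
      ⟨fun h ρ hρ ρ' hρ' h₁ h₂ => dist_comm (ρ' n) (ρ n) ▸ h ρ' hρ' ρ hρ h₂ h₁,
        fun h ρ hρ ρ' hρ' h₁ h₂ => dist_comm (ρ' n) (ρ n) ▸ h ρ' hρ' ρ hρ h₂ h₁⟩
end

section
/- Let (X,d) be a metric space, O ∈ X, and let D > 0 and A ≥ 2D+2 be real numbers. Let ℛ be a set of maps r : ℕ → X with r(0)=O and d(r(m),r(n)) = |m−n| for all m,n ∈ ℕ, such that d(r(s),r'(s)) ≤ (s/t)·d(r(t),r'(t)) + D for all r,r' ∈ ℛ and all integers 0 < s < t. Define r ~ r' iff d(r(n),r'(n)) ≤ D for all n, assume ~ is transitive, and let g be the gap function on ℛ/~ given by g(ξ,η) = 1/N(ξ,η) for ξ ≠ η (where N(ξ,η) is the least n₀ such that d(ρ(n),ρ'(n)) ≥ A for all n ≥ n₀, ρ ∈ ξ, ρ' ∈ η) and g(ξ,ξ)=0. Choose for each class ξ ∈ ℛ/~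 a representative r_ξ ∈ ξ. Then the family (r_ξ)_{ξ∈ℛ/~} is conical with respect to g for the constant C = A+3D; that is: (1) for every N > 0 there exists ε > 0 such that for all integers t ≤ N, if g(ξ,η) ≤ ε then d(r_ξ(t),r_η(t)) ≤ A+3D; (2) for every L ≥ A+3D and every ε' > 0 there exists N' > 0 such that for all integers t ≥ N', if d(r_ξ(t),r_η(t)) ≤ L then g(ξ,η) ≤ ε'. -/
open scoped Classical

/-- If two sequences satisfy the almost-convexity inequality and are more than `D` apart at some
positive time, their distance is eventually at least any prescribed bound. -/
theorem eventually_le_dist_of_almost_convex {X : Type*} [MetricSpace X] {D : ℝ} {r r' : ℕ → X}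
    (hconv : ∀ s t : ℕ, 0 < s → s < t → t * (dist (r s) (r' s) - D) ≤ s * dist (r t) (r' t))
    {s : ℕ} (hs : 0 < s) (hD : D < dist (r s) (r' s)) (B : ℝ) :
    ∃ n₀ : ℕ, ∀ n ≥ n₀, B ≤ dist (r n) (r' n) := by
  have hδ : 0 < dist (r s) (r' s) - D := sub_pos.2 hD
  obtain ⟨k, hk⟩ := exists_nat_ge (s * B / (dist (r s) (r' s) - D))
  refine ⟨max (s + 1) k, fun n hn => ?_⟩
  have hkn : (k : ℝ) ≤ n := by exact_mod_cast (le_max_right _ _).trans hn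
  have h := hconv s n hs ((le_max_left _ _).trans hn)
  have hsB : s * B ≤ n * (dist (r s) (r' s) - D) := (div_le_iff₀ hδ).1 (hk.trans hkn)
  exact le_of_mul_le_mul_left (hsB.trans h) (Nat.cast_pos.2 hs)

/-- Discrete geodesic rays based at `O` with the almost-convexity property (constant
`D`), `r ~ r'` iff `dist (r n) (r' n) ≤ D` for all `n` (assumed transitive), and the
gap function `g(ξ,η) = 1/N(ξ,η)` on the quotient, where `N(ξ,η)` is the least `n₀`
such that representatives of the two classes stay at distance `≥ A` from time `n₀` on.
Choosing a representative `rep r` of each class, the family of chosen rays is conical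
with respect to `g` for the constant `C = A + 3D`:
(1) for every `N > 0` there is `ε > 0` such that for integers `t ≤ N`, `g ≤ ε` implies
`dist (rep r t) (rep r' t) ≤ A + 3D`;
(2) for every `L ≥ A + 3D` and `ε' > 0` there is `N' > 0` such that for integers
`t ≥ N'`, `dist (rep r t) (rep r' t) ≤ L` implies `g ≤ ε'`. -/
theorem rays_conical_wrt_gapFunction {X : Type*} [MetricSpace X] (O : X)
    (D A : ℝ) (hD : 0 < D) (hA : 2 * D + 2 ≤ A)
    (R : Set (ℕ → X))
    (hray : ∀ r ∈ R, r 0 = O ∧ ∀ m n : ℕ, dist (r m) (r n) = |(m : ℝ) - (n : ℝ)|)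
    (hconv : ∀ r ∈ R, ∀ r' ∈ R, ∀ s t : ℕ, 0 < s → s < t →
      dist (r s) (r' s) ≤ ((s : ℝ) / (t : ℝ)) * dist (r t) (r' t) + D)
    (sim : (ℕ → X) → (ℕ → X) → Prop)
    (hsim : ∀ r r' : ℕ → X, (sim r r' ↔ ∀ n : ℕ, dist (r n) (r' n) ≤ D))
    (htrans : ∀ r ∈ R, ∀ r' ∈ R, ∀ r'' ∈ R, sim r r' → sim r' r'' → sim r r'')
    (rep : (ℕ → X) → (ℕ → X))
    (hrep : ∀ r ∈ R, rep r ∈ R ∧ sim (rep r) r)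
    (hrep_class : ∀ r ∈ R, ∀ r' ∈ R, sim r r' → rep r = rep r') :
    let Nfun : (ℕ → X) → (ℕ → X) → ℕ := fun r r' =>
      sInf {n₀ : ℕ | ∀ n ≥ n₀, ∀ ρ ∈ R, ∀ ρ' ∈ R, sim ρ r → sim ρ' r' →
        A ≤ dist (ρ n) (ρ' n)}
    let g : (ℕ → X) → (ℕ → X) → ℝ := fun r r' =>
      if sim r r' then 0 else 1 / (Nfun r r' : ℝ)
    (∀ N > (0 : ℝ), ∃ ε > (0 : ℝ), ∀ t : ℕ, (t : ℝ) ≤ N →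
      ∀ r ∈ R, ∀ r' ∈ R, g r r' ≤ ε →
        dist (rep r t) (rep r' t) ≤ A + 3 * D) ∧
    (∀ L : ℝ, A + 3 * D ≤ L → ∀ ε' > (0 : ℝ), ∃ N' > (0 : ℝ), ∀ t : ℕ, N' ≤ (t : ℝ) →
      ∀ r ∈ R, ∀ r' ∈ R, dist (rep r t) (rep r' t) ≤ L → g r r' ≤ ε') := by
  intro Nfun g
  have hzero : ∀ r ∈ R, ∀ r' ∈ R, dist (r 0) (r' 0) = 0 := fun r hr r' hr' => by
    rw [(hray r hr).1, (hray r' hr').1, dist_self]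
  have hsymm : ∀ r r', sim r r' → sim r' r := fun r r' h =>
    (hsim _ _).2 fun n => by rw [dist_comm]; exact (hsim _ _).1 h n
  have hrefl : ∀ r, sim r r := fun r => (hsim _ _).2 fun n => by rw [dist_self]; exact hD.le
  have hdiv : ∀ r ∈ R, ∀ r' ∈ R, ∀ s t : ℕ, 0 < s → s < t →
      t * (dist (r s) (r' s) - D) ≤ s * dist (r t) (r' t) := by
    intro r hr r' hr' s t hs hst
    have ht : (0 : ℝ) < t := by exact_mod_cast hs.trans hst
    have h := sub_le_iff_le_add.2 (hconv r hr r' hr' s t hs hst)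
    rwa [div_mul_eq_mul_div, le_div_iff₀' ht] at h
  have hclose : ∀ r₁ r₂ r₁' r₂', sim r₁ r₂ → sim r₁' r₂' → ∀ n,
      dist (r₁ n) (r₁' n) ≤ dist (r₂ n) (r₂' n) + 2 * D := by
    intro r₁ r₂ r₁' r₂' h h' n
    have h₁ := (hsim _ _).1 h n
    have h₂ := (hsim _ _).1 (hsymm _ _ h') n
    linarith [dist_triangle4 (r₁ n) (r₂ n) (r₂' n) (r₁' n)]
  have hNfun : ∀ r ∈ R, ∀ r' ∈ R, ¬ sim r r' → ∀ n ≥ Nfun r r', ∀ ρ ∈ R, ∀ ρ' ∈ R,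
      sim ρ r → sim ρ' r' → A ≤ dist (ρ n) (ρ' n) := by
    intro r hr r' hr' hns
    refine Nat.sInf_mem (s := {n₀ : ℕ | ∀ n ≥ n₀, ∀ ρ ∈ R, ∀ ρ' ∈ R, sim ρ r → sim ρ' r' →
      A ≤ dist (ρ n) (ρ' n)}) ?_
    rw [hsim] at hns
    push Not at hns
    obtain ⟨s, hs⟩ := hns
    have hs0 : 0 < s := by
      refine Nat.pos_of_ne_zero fun h => ?_
      rw [h, hzero r hr r' hr'] at hs
      exact hs.not_gt hD
    obtain ⟨n₀, hn₀⟩ := eventually_le_dist_of_almost_convex (hdiv r hr r' hr') hs0 hs (A + 2 * D)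
    refine ⟨n₀, fun n hn ρ _ ρ' _ h h' => ?_⟩
    linarith [hn₀ n hn, hclose r ρ r' ρ' (hsymm _ _ h) (hsymm _ _ h') n]
  have hNpos : ∀ r ∈ R, ∀ r' ∈ R, ¬ sim r r' → 0 < Nfun r r' := by
    intro r hr r' hr' hns
    refine Nat.pos_of_ne_zero fun h => ?_
    have := hNfun r hr r' hr' hns 0 h.le r hr r' hr' (hrefl r) (hrefl r')
    rw [hzero r hr r' hr'] at this
    linarith
  have hg : ∀ r r', ¬ sim r r' → g r r' = 1 / (Nfun r r' : ℝ) := fun r r' h => if_neg h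
  constructor
  · intro N _
    refine ⟨1 / ((⌈N⌉₊ + 2 : ℕ) : ℝ), by positivity, fun t ht r hr r' hr' hgr => ?_⟩
    by_cases hs : sim r r'
    · rw [hrep_class r hr r' hr' hs, dist_self]
      linarith
    rcases Nat.eq_zero_or_pos t with rfl | ht0
    · rw [hzero _ (hrep r hr).1 _ (hrep r' hr').1]
      linarith
    have hpos : (0 : ℝ) < Nfun r r' := Nat.cast_pos.2 (hNpos r hr r' hr' hs)
    rw [hg r r' hs, one_div_le_one_div hpos (by positivity)] at hgr
    have hlarge : ⌈N⌉₊ + 2 ≤ Nfun r r' := by exact_mod_cast hgr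
    have hnot := Nat.notMem_of_lt_sInf (show ⌈N⌉₊ + 1 < Nfun r r' by omega)
    simp only [Set.mem_ofPred_eq] at hnot
    push Not at hnot
    obtain ⟨n, hn, ρ, hρ, ρ', hρ', h, h', hlt⟩ := hnot
    have htN : t ≤ ⌈N⌉₊ := by exact_mod_cast ht.trans (Nat.le_ceil N)
    have htn : t < n := by omega
    have hfrac : (t : ℝ) / n ≤ 1 := div_le_one_of_le₀ (by exact_mod_cast htn.le) (by positivity)
    have hc := hconv ρ hρ ρ' hρ' t n ht0 htn
    have hm := mul_le_of_le_one_left (dist_nonneg (x := ρ n) (y := ρ' n)) hfrac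
    have hrr := htrans _ (hrep r hr).1 _ hr _ hρ (hrep r hr).2 (hsymm _ _ h)
    have hrr' := htrans _ (hrep r' hr').1 _ hr' _ hρ' (hrep r' hr').2 (hsymm _ _ h')
    linarith [hclose _ _ _ _ hrr hrr' t]
  · intro L hL ε hε
    have hL1 : 1 ≤ L := by linarith
    have hL0 : 0 < L := by linarith
    refine ⟨L / ε, by positivity, fun t ht r hr r' hr' hd => ?_⟩
    by_cases hs : sim r r'
    · exact (if_pos hs : g r r' = 0).trans_le hε.le
    have hn := hNpos r hr r' hr' hs
    have hn' : (0 : ℝ) < Nfun r r' := Nat.cast_pos.2 hn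
    have key : (t : ℝ) ≤ Nfun r r' * L := by
      rcases le_or_gt t (Nfun r r') with htn | htn
      · have : (t : ℝ) ≤ Nfun r r' := by exact_mod_cast htn
        exact this.trans (le_mul_of_one_le_right hn'.le hL1)
      · have hAd := hNfun r hr r' hr' hs _ le_rfl _ (hrep r hr).1 _ (hrep r' hr').1
          (hrep r hr).2 (hrep r' hr').2
        have hc := hdiv _ (hrep r hr).1 _ (hrep r' hr').1 _ t hn htn
        have hu := mul_le_mul_of_nonneg_left hd hn'.le
        exact (le_mul_of_one_le_right (Nat.cast_nonneg t) (by linarith)).trans (hc.trans hu)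
    rw [hg r r' hs, div_le_iff₀ hn']
    have hLε : L ≤ t * ε := (div_le_iff₀ hε).1 ht
    refine le_of_mul_le_mul_right ?_ hL0
    linarith [mul_le_mul_of_nonneg_right key hε.le]
end
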